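/- Let f : X → X be a continuous map of a compact metric space and φ : X → ℝ continuous. If ν₀ is an f-invariant Borel probability measure maximizing ν ↦ ∫ φ dν over all f-invariant Borel probability measures, and if for some point x₀ ∈ X the 'tree pressure' limsup_{n→∞} (1/n) log Σ_{y∈f^{−n}(x₀)} exp(S_n(φ)(y)) is strictly greater than ∫ φ dν₀ and bounded above by P(f,φ), then φ is hyperbolic for f, i.e. for some n ≥ 1, sup_X (1/n) S_n(φ) < P(f,φ). -/

import Mathlib

open MeasureTheory Filter Set

/-- The uniform probability measure on the orbit segment `x, f x, …, f^[n] x`. -/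
noncomputable def empiricalMeasure {X : Type*} [MeasurableSpace X] (f : X → X) (n : ℕ) (x : X) :
    Measure X :=
  ((n + 1 : ℕ) : ENNReal)⁻¹ • ∑ j ∈ Finset.range (n + 1), Measure.dirac (f^[j] x)

instance isProbabilityMeasure_empiricalMeasure {X : Type*} [MeasurableSpace X] (f : X → X)
    (n : ℕ) (x : X) : IsProbabilityMeasure (empiricalMeasure f n x) where
  measure_univ := by
    simp only [empiricalMeasure, Measure.smul_apply, Measure.finsetSum_apply, measure_univ,
      Finset.sum_const, Finset.card_range, nsmul_eq_mul, mul_one, smul_eq_mul]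
    exact ENNReal.inv_mul_cancel (by simp) (ENNReal.natCast_ne_top _)

theorem integral_empiricalMeasure {X : Type*} [MeasurableSpace X] (f : X → X) {g : X → ℝ}
    (hg : StronglyMeasurable g) (n : ℕ) (x : X) :
    ∫ y, g y ∂(empiricalMeasure f n x) = birkhoffAverage ℝ f g (n + 1) x := by
  rw [empiricalMeasure, integral_smul_measure,
    integral_finsetSum_measure fun j _ => integrable_dirac' hg (by simp),
    ENNReal.toReal_inv, ENNReal.toReal_natCast]
  simp [birkhoffAverage, birkhoffSum, integral_dirac' _ _ hg]

/-- The difference of Birkhoff averages along an orbit and along its shift tends to zero,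
uniformly in the starting point. -/
theorem tendsto_birkhoffAverage_comp_sub {X : Type*} (f : X → X) {g : X → ℝ}
    (hg : Bornology.IsBounded (range g)) (x : ℕ → X) :
    Tendsto (fun n => birkhoffAverage ℝ f (g ∘ f) (n + 1) (x n) -
      birkhoffAverage ℝ f g (n + 1) (x n)) atTop (nhds 0) := by
  obtain ⟨C, hC⟩ := Metric.isBounded_range_iff.1 hg
  refine squeeze_zero_norm (a := fun n : ℕ => C * (1 / ((n : ℝ) + 1))) (fun n => ?_) ?_
  · have hshift : birkhoffAverage ℝ f (g ∘ f) (n + 1) (x n) =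
        birkhoffAverage ℝ f g (n + 1) (f (x n)) := by
      simp only [birkhoffAverage, birkhoffSum, Function.comp_apply,
        ← Function.iterate_succ_apply, ← Function.iterate_succ_apply']
    rw [hshift, ← dist_eq_norm, dist_birkhoffAverage_apply_birkhoffAverage, div_eq_mul_one_div]
    push_cast
    gcongr
    exact hC _ _
  · simpa using tendsto_one_div_add_atTop_nhds_zero_nat.const_mul C

/-- Every sequence of empirical measures along longer and longer orbit segments of a continuous
map accumulates at an invariant probability measure. -/
theorem exists_measurePreserving_tendsto_birkhoffAverage {X : Type*} [TopologicalSpace X]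
    [CompactSpace X] [T2Space X] [HasOuterApproxClosed X] [MeasurableSpace X] [BorelSpace X]
    {f : X → X} (hf : Continuous f) (x : ℕ → X) :
    ∃ ν : Measure X, IsProbabilityMeasure ν ∧ MeasurePreserving f ν ν ∧
      ∀ g : X → ℝ, Continuous g →
        Tendsto (fun n => birkhoffAverage ℝ f g (n + 1) (x n)) (hyperfilter ℕ)
          (nhds (∫ y, g y ∂ν)) := by
  let μ : ℕ → ProbabilityMeasure X := fun n => ⟨empiricalMeasure f n (x n), inferInstance⟩
  obtain ⟨ν, -, hν⟩ := isCompact_univ.ultrafilter_le_nhds ((hyperfilter ℕ).map μ) (by simp)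
  have hlim : ∀ g : X → ℝ, Continuous g →
      Tendsto (fun n => birkhoffAverage ℝ f g (n + 1) (x n)) (hyperfilter ℕ)
        (nhds (∫ y, g y ∂(ν : Measure X))) := by
    intro g hg
    have h := ProbabilityMeasure.tendsto_iff_forall_integral_tendsto.1
      (show Tendsto μ (hyperfilter ℕ) (nhds ν) from hν)
      (BoundedContinuousFunction.mkOfCompact ⟨g, hg⟩)
    refine h.congr fun n => ?_
    exact integral_empiricalMeasure f
      (hg.stronglyMeasurable_of_hasCompactSupport (HasCompactSupport.of_compactSpace g)) n (x n)
  refine ⟨ν, inferInstance, ⟨hf.measurable, ?_⟩, hlim⟩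
  have := Measure.isProbabilityMeasure_map (μ := (ν : Measure X)) hf.aemeasurable
  refine ext_of_forall_integral_eq_of_IsFiniteMeasure fun g => ?_
  rw [integral_map hf.aemeasurable
    (g.continuous.stronglyMeasurable_of_hasCompactSupport
      (HasCompactSupport.of_compactSpace g)).aestronglyMeasurable]
  refine sub_eq_zero.1 (tendsto_nhds_unique
    ((hlim _ (g.continuous.comp hf)).sub (hlim g g.continuous)) ?_)
  exact (tendsto_birkhoffAverage_comp_sub f g.isBounded_range x).mono_left
    (hyperfilter_le_cofinite.trans Nat.cofinite_eq_atTop.le)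

/-- If `ν₀` maximizes `ν ↦ ∫ φ dν` over invariant probability measures and the tree
pressure at some point `x₀` is strictly bigger than `∫ φ dν₀` while bounded above by
the pressure `P(f,φ)`, then `φ` is hyperbolic for `f`. -/
theorem stmt18 {X : Type*} [MetricSpace X] [CompactSpace X] [Nonempty X]
    [MeasurableSpace X] [BorelSpace X]
    (f : X → X) (hf : Continuous f) (φ : X → ℝ) (hφ : Continuous φ)
    (hent : Measure X → ℝ) (P : ℝ)
    (hP : P = sSup {r : ℝ | ∃ ν : Measure X, IsProbabilityMeasure ν ∧
      MeasurePreserving f ν ν ∧ r = hent ν + ∫ x, φ x ∂ν})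
    (ν₀ : Measure X) [IsProbabilityMeasure ν₀] (hν₀ : MeasurePreserving f ν₀ ν₀)
    (hmax : ∀ μ : Measure X, IsProbabilityMeasure μ → MeasurePreserving f μ μ →
      ∫ x, φ x ∂μ ≤ ∫ x, φ x ∂ν₀)
    (x₀ : X) (hfin : ∀ n : ℕ, (f^[n] ⁻¹' {x₀}).Finite)
    (L : ℝ)
    (hL : L = Filter.atTop.limsup (fun n : ℕ => (1 / (n : ℝ)) *
      Real.log (∑ y ∈ (hfin n).toFinset,
        Real.exp (∑ j ∈ Finset.range n, φ (f^[j] y)))))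
    (hgap : ∫ x, φ x ∂ν₀ < L) (hLP : L ≤ P) :
    ∃ n : ℕ, 1 ≤ n ∧
      (⨆ x : X, (1 / (n : ℝ)) * ∑ j ∈ Finset.range n, φ (f^[j] x)) < P := by
  by_contra! hcon
  have hmaxpt : ∀ n : ℕ, ∃ x : X, P ≤ birkhoffAverage ℝ f φ (n + 1) x := by
    intro n
    have hcont : Continuous (birkhoffAverage ℝ f φ (n + 1)) := by
      have hsum : Continuous fun x => ∑ j ∈ Finset.range (n + 1), φ (f^[j] x) :=
        continuous_finsetSum _ fun j _ => hφ.comp (hf.iterate j)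
      exact hsum.const_smul ((n + 1 : ℕ) : ℝ)⁻¹
    obtain ⟨x, -, hx⟩ := isCompact_univ.exists_isMaxOn univ_nonempty hcont.continuousOn
    refine ⟨x, (hcon (n + 1) (by simp)).trans (ciSup_le fun y => ?_)⟩
    simpa [birkhoffAverage, birkhoffSum] using hx (mem_univ y)
  choose x hx using hmaxpt
  obtain ⟨ν, hprob, hinv, hlim⟩ := exists_measurePreserving_tendsto_birkhoffAverage hf x
  have hPν : P ≤ ∫ y, φ y ∂ν := ge_of_tendsto' (hlim φ hφ) hx
  linarith [hmax ν hprob hinv]
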